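/- arXiv:math/0009076 — 9 statements merged into one kernel-verified Lean document; each statement's English description precedes it below -/
import Mathlib

section
/- Let R be a commutative ring and P a Poisson algebra over R, i.e. a commutative R-algebra equipped with an R-bilinear Lie bracket ⁅·,·⁆ satisfying the Leibniz rule ⁅a, b*c⁆ = b*⁅a,c⁆ + ⁅a,b⁆*c. Let V be an R-submodule of P and, for k ≥ 1, let V^k denote the k-th power of V under submodule multiplication. Then for all m, n ≥ 1, the R-submodule spanned by {⁅a,b⁆ : a ∈ V^m, b ∈ V^n} is contained in the R-submodule spanned by {⁅v,c⁆ : v ∈ V, c ∈ V^(m+n-1)}. -/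
/-- Cyclic identity relating the Leibniz rule to skew-symmetry: `⁅xy, z⁆ = ⁅x, yz⁆ + ⁅y, zx⁆`. -/
theorem bracket_mul_left_eq {R P : Type*} [CommRing R] [CommRing P] [Algebra R P]
    (B : P →ₗ[R] P →ₗ[R] P) (hskew : ∀ a : P, B a a = 0)
    (hleibniz : ∀ a b c : P, B a (b * c) = b * B a c + B a b * c) (x y z : P) :
    B (x * y) z = B x (y * z) + B y (z * x) := by
  have hneg (a b : P) : B a b = -B b a := by
    have h := hskew (a + b)
    simp only [map_add, LinearMap.add_apply, hskew, zero_add, add_zero] at h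
    linear_combination h
  rw [hneg (x * y) z, hleibniz, hleibniz, hleibniz]
  linear_combination (-x) * hneg y z - y * hneg x z - z * hneg x y

theorem bracket_mem_span_of_mem_pow {R P : Type*} [CommRing R] [CommRing P] [Algebra R P]
    (B : P →ₗ[R] P →ₗ[R] P) (hskew : ∀ a : P, B a a = 0)
    (hleibniz : ∀ a b c : P, B a (b * c) = b * B a c + B a b * c)
    (V : Submodule R P) (m n : ℕ) {a b : P} (ha : a ∈ V ^ (m + 1)) (hb : b ∈ V ^ n) :
    B a b ∈ Submodule.span R {x : P | ∃ v ∈ V, ∃ c ∈ V ^ (m + n), x = B v c} := by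
  induction m generalizing n a b with
  | zero =>
    rw [zero_add, pow_one] at ha
    exact Submodule.subset_span ⟨a, ha, b, by rwa [zero_add], rfl⟩
  | succ m ih =>
    rw [pow_succ'] at ha
    induction ha using Submodule.mul_induction_on' with
    | mem_mul_mem x hx y hy =>
      rw [bracket_mul_left_eq B hskew hleibniz]
      refine add_mem (Submodule.subset_span ⟨x, hx, y * b, ?_, rfl⟩) ?_
      · rw [pow_add]
        exact Submodule.mul_mem_mul hy hb
      · have hbx : b * x ∈ V ^ (n + 1) := by
          rw [pow_succ]
          exact Submodule.mul_mem_mul hb hx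
        rw [add_right_comm m 1 n]
        exact ih (n + 1) hy hbx
    | add x _ y _ hx hy =>
      rw [map_add, LinearMap.add_apply]
      exact add_mem hx hy

/-- In a Poisson algebra `P` over a commutative ring `R` (a commutative
`R`-algebra with an `R`-bilinear Lie bracket `B` satisfying the Leibniz rule), for any
`R`-submodule `V` and `m, n ≥ 1`, the span of brackets of elements of `V ^ m` with
elements of `V ^ n` is contained in the span of brackets of elements of `V` with
elements of `V ^ (m + n - 1)`. -/
theorem span_bracket_pow_le {R P : Type*} [CommRing R] [CommRing P] [Algebra R P]
    (B : P →ₗ[R] P →ₗ[R] P)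
    (hskew : ∀ a : P, B a a = 0)
    (hjacobi : ∀ a b c : P, B a (B b c) = B (B a b) c + B b (B a c))
    (hleibniz : ∀ a b c : P, B a (b * c) = b * B a c + B a b * c)
    (V : Submodule R P) (m n : ℕ) (hm : 1 ≤ m) (hn : 1 ≤ n) :
    Submodule.span R {x : P | ∃ a ∈ V ^ m, ∃ b ∈ V ^ n, x = B a b} ≤
      Submodule.span R {x : P | ∃ v ∈ V, ∃ c ∈ V ^ (m + n - 1), x = B v c} := by
  obtain ⟨m, rfl⟩ := Nat.exists_eq_add_of_le' hm
  rw [Submodule.span_le]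
  rintro _ ⟨a, ha, b, hb, rfl⟩
  rw [show m + 1 + n - 1 = m + n by omega]
  exact bracket_mem_span_of_mem_pow B hskew hleibniz V m n ha hb
end

section
/- Let P be a Poisson algebra over ℝ, let V ⊆ P be a subspace generating P as an ℝ-algebra, let C = {c ∈ P : ⁅c,a⁆ = 0 for all a ∈ P} be the Lie center, and let D_V be the ℝ-span of {⁅v,b⁆ : v ∈ V, b ∈ P}. If P is the internal direct sum of the subspaces C and D_V (C ∩ D_V = {0} and C + D_V = P), then P is the internal direct sum of C and the derived ideal P' (the span of all brackets): P = C ⊕ P'. -/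
/-- In a Poisson algebra over a commutative ring, `⁅a * b, c⁆ = ⁅a, b * c⁆ + ⁅b, a * c⁆`. -/
theorem poisson_mul_bracket {R P : Type*} [CommRing R] [CommRing P] [Algebra R P]
    (B : P →ₗ[R] P →ₗ[R] P) (hskew : ∀ a : P, B a a = 0)
    (hleibniz : ∀ a b c : P, B a (b * c) = b * B a c + B a b * c) (a b c : P) :
    B (a * b) c = B a (b * c) + B b (a * c) := by
  have hB : B.IsAlt := hskew
  rw [← hB.neg c (a * b), hleibniz, hleibniz, hleibniz, ← hB.neg a c, ← hB.neg b c,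
    ← hB.neg a b]
  ring

/-- If `V` generates a Poisson algebra `P`, then every bracket lies in the span of the brackets
whose first argument is in `V`. -/
theorem poisson_bracket_mem_span {R P : Type*} [CommRing R] [CommRing P] [Algebra R P]
    (B : P →ₗ[R] P →ₗ[R] P) (hskew : ∀ a : P, B a a = 0)
    (hleibniz : ∀ a b c : P, B a (b * c) = b * B a c + B a b * c)
    (V : Submodule R P) (hgen : Algebra.adjoin R (V : Set P) = ⊤) (a b : P) :
    B a b ∈ Submodule.span R {x : P | ∃ v ∈ V, ∃ b : P, x = B v b} := by
  have ha : a ∈ Algebra.adjoin R (V : Set P) := hgen ▸ Algebra.mem_top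
  induction ha using Algebra.adjoin_induction generalizing b with
  | mem v hv => exact Submodule.subset_span ⟨v, hv, b, rfl⟩
  | algebraMap r =>
    have hB : B.IsAlt := hskew
    have hone : B b 1 = 0 := by simpa using hleibniz b 1 1
    have hone' : B 1 b = 0 := by rw [← hB.neg b 1, hone, neg_zero]
    simp [Algebra.algebraMap_eq_smul_one, hone']
  | add x y _ _ hx hy =>
    rw [map_add, LinearMap.add_apply]
    exact add_mem (hx b) (hy b)
  | mul x y _ _ hx hy =>
    rw [poisson_mul_bracket B hskew hleibniz]
    exact add_mem (hx _) (hy _)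

/-- Let `P` be a Poisson algebra over `ℝ`, `V` a subspace generating `P` as
an `ℝ`-algebra, `C` the Lie center, and `D_V` the span of brackets `⁅v, b⁆`, `v ∈ V`,
`b ∈ P`. If `P = C ⊕ D_V` (internal direct sum), then `P = C ⊕ P'`, where `P'` is the
derived ideal (the span of all brackets). -/
theorem center_derived_decomposition {P : Type*} [CommRing P] [Algebra ℝ P]
    (B : P →ₗ[ℝ] P →ₗ[ℝ] P)
    (hskew : ∀ a : P, B a a = 0)
    (hjacobi : ∀ a b c : P, B a (B b c) = B (B a b) c + B b (B a c))
    (hleibniz : ∀ a b c : P, B a (b * c) = b * B a c + B a b * c)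
    (V : Submodule ℝ P) (hgen : Algebra.adjoin ℝ (V : Set P) = ⊤)
    (C : Submodule ℝ P) (hC : ∀ c : P, c ∈ C ↔ ∀ a : P, B c a = 0)
    (DV : Submodule ℝ P)
    (hDV : DV = Submodule.span ℝ {x : P | ∃ v ∈ V, ∃ b : P, x = B v b})
    (hmeet : C ⊓ DV = ⊥) (hjoin : C ⊔ DV = ⊤) :
    C ⊓ Submodule.span ℝ {x : P | ∃ a b : P, x = B a b} = ⊥ ∧
      C ⊔ Submodule.span ℝ {x : P | ∃ a b : P, x = B a b} = ⊤ := by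
  have hspan : Submodule.span ℝ {x : P | ∃ a b : P, x = B a b} = DV := by
    rw [hDV]
    apply le_antisymm
    · rw [Submodule.span_le]
      rintro _ ⟨a, b, rfl⟩
      exact poisson_bracket_mem_span B hskew hleibniz V hgen a b
    · apply Submodule.span_mono
      rintro _ ⟨v, -, b, rfl⟩
      exact ⟨v, b, rfl⟩
  rw [hspan]
  exact ⟨hmeet, hjoin⟩
end

section
/- Let P be a unital Poisson algebra over ℝ, let C = {c ∈ P : ⁅c,a⁆ = 0 for all a ∈ P} be its Lie center, and let D be the ℝ-span of all brackets ⁅a,b⁆, a,b ∈ P. Assume C ∩ D = {0}. Let I be a Poisson ideal of P (an ideal of the commutative ring P that is also a Lie ideal) with 1 ∉ I, and assume I = (I ∩ C) + (I ∩ D). Then for every r ∈ ℝ and every d ∈ D, if r·1 − d ∈ I then r = 0. -/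
/-- Let `P` be a unital Poisson algebra over `ℝ` with Lie center `C` and
derived ideal `D` (span of all brackets), and assume `C ∩ D = {0}`. If `I` is a Poisson
ideal of `P` with `1 ∉ I` such that `I = (I ∩ C) + (I ∩ D)`, then for every `r : ℝ` and
`d ∈ D`, `r • 1 - d ∈ I` implies `r = 0`. -/
theorem no_constants_in_derived_mod_ideal {P : Type*} [CommRing P] [Algebra ℝ P]
    (B : P →ₗ[ℝ] P →ₗ[ℝ] P)
    (hskew : ∀ a : P, B a a = 0)
    (hjacobi : ∀ a b c : P, B a (B b c) = B (B a b) c + B b (B a c))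
    (hleibniz : ∀ a b c : P, B a (b * c) = b * B a c + B a b * c)
    (C : Submodule ℝ P) (hC : ∀ c : P, c ∈ C ↔ ∀ a : P, B c a = 0)
    (D : Submodule ℝ P) (hD : D = Submodule.span ℝ {x : P | ∃ a b : P, x = B a b})
    (hCD : C ⊓ D = ⊥)
    (I : Ideal P) (hIlie : ∀ f : P, ∀ u ∈ I, B f u ∈ I) (hone : (1 : P) ∉ I)
    (hIdecomp : I.restrictScalars ℝ =
      (I.restrictScalars ℝ ⊓ C) ⊔ (I.restrictScalars ℝ ⊓ D)) :
    ∀ r : ℝ, ∀ d ∈ D, r • (1 : P) - d ∈ I → r = 0 := by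
  intro r d hd hrd
  have hone_center : (1 : P) ∈ C := by
    refine (hC 1).2 fun a => ?_
    have hderiv : B a 1 = 0 := by simpa using hleibniz a 1 1
    have hadd := hskew (1 + a)
    simpa [hskew, hderiv] using hadd
  have hmem : r • (1 : P) - d ∈ I.restrictScalars ℝ := hrd
  rw [hIdecomp] at hmem
  obtain ⟨u, ⟨huI, huC⟩, v, ⟨-, hvD⟩, huv⟩ := Submodule.mem_sup.1 hmem
  have heq : r • (1 : P) - u = d + v := by linear_combination -huv
  have hCD_mem : r • (1 : P) - u ∈ C ⊓ D :=
    ⟨C.sub_mem (C.smul_mem r hone_center) huC, heq ▸ D.add_mem hd hvD⟩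
  rw [hCD, Submodule.mem_bot, sub_eq_zero] at hCD_mem
  by_contra hr
  refine hone ?_
  have hinv : r⁻¹ • u ∈ I.restrictScalars ℝ := Submodule.smul_mem _ _ huI
  rwa [← hCD_mem, inv_smul_smul₀ hr] at hinv
end

section
/- Let P be a unital Poisson algebra over ℝ with no nonzero nilpotent elements for the associative multiplication (P is reduced). If P is simple as a Poisson algebra, i.e. the only Poisson ideals of P are {0} and P, then P is essentially simple as a Lie algebra: every Lie ideal L of P either is contained in the Lie center Z(P) = {c ∈ P : ⁅c,a⁆ = 0 for all a ∈ P} or contains the derived ideal P', the ℝ-span of all brackets ⁅a,b⁆ with a,b ∈ P. -/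
/-- If the inner derivation of `u` squares to zero in a reduced Poisson algebra, then `u` is
a Casimir element. -/
theorem bracket_eq_zero_of_bracket_bracket_eq_zero {P : Type*} [CommRing P] [Algebra ℝ P]
    [IsReduced P] (B : P →ₗ[ℝ] P →ₗ[ℝ] P)
    (hleibniz : ∀ a b c : P, B a (b * c) = b * B a c + B a b * c)
    {u : P} (hu : ∀ a : P, B u (B u a) = 0) (a : P) : B u a = 0 := by
  have h := hu (a * a)
  rw [hleibniz, map_add, hleibniz, hleibniz, hu a] at h
  have h2 : (2 : ℝ) • (B u a * B u a) = 0 := by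
    rw [two_smul]
    linear_combination h
  have h3 : B u a * B u a = 0 := (smul_eq_zero_iff_right (two_ne_zero' ℝ)).mp h2
  exact IsReduced.eq_zero _ ⟨2, by rw [pow_two, h3]⟩

/-- The elements all of whose brackets lie in a Lie ideal are closed under the associative
multiplication. -/
theorem bracket_mul_mem_of_forall_bracket_mem {P : Type*} [CommRing P] [Algebra ℝ P]
    (B : P →ₗ[ℝ] P →ₗ[ℝ] P)
    (hanti : ∀ a b : P, B a b = -B b a)
    (hleibniz : ∀ a b c : P, B a (b * c) = b * B a c + B a b * c)
    (L : Submodule ℝ P) {f g : P} (hf : ∀ h : P, B f h ∈ L) (hg : ∀ h : P, B g h ∈ L)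
    (h : P) : B (f * g) h ∈ L := by
  have key : B (f * g) h = B f (g * h) + B g (f * h) := by
    rw [hanti (f * g) h, hleibniz, hleibniz, hleibniz, hanti h g, hanti h f, hanti g f]
    ring
  rw [key]
  exact L.add_mem (hf _) (hg _)

/-- A unital Poisson algebra over `ℝ` with no nonzero associative
nilpotents which is simple as a Poisson algebra (its only Poisson ideals are `{0}` and
`P`) is essentially simple as a Lie algebra: every Lie ideal `L` is either contained in
the Lie center or contains the derived ideal `P'` (the span of all brackets). -/
theorem simple_imp_essentially_simple {P : Type*} [CommRing P] [Algebra ℝ P]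
    (B : P →ₗ[ℝ] P →ₗ[ℝ] P)
    (hskew : ∀ a : P, B a a = 0)
    (hjacobi : ∀ a b c : P, B a (B b c) = B (B a b) c + B b (B a c))
    (hleibniz : ∀ a b c : P, B a (b * c) = b * B a c + B a b * c)
    (hreduced : IsReduced P)
    (hsimple : ∀ I : Ideal P, (∀ f : P, ∀ u ∈ I, B f u ∈ I) → I = ⊥ ∨ I = ⊤) :
    ∀ L : Submodule ℝ P, (∀ f : P, ∀ u ∈ L, B f u ∈ L) →
      (∀ c ∈ L, ∀ a : P, B c a = 0) ∨
        Submodule.span ℝ {x : P | ∃ a b : P, x = B a b} ≤ L := by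
  intro L hL
  have hanti : ∀ a b : P, B a b = -B b a := by
    intro a b
    have h := hskew (a + b)
    simp only [map_add, LinearMap.add_apply, hskew, zero_add, add_zero] at h
    linear_combination h
  have hL' : ∀ u ∈ L, ∀ f : P, B u f ∈ L := fun u hu f => by
    rw [hanti]
    exact L.neg_mem (hL f u hu)
  -- The largest associative ideal inside `{f | ∀ h, B f h ∈ L}` is a Poisson ideal.
  let J : Ideal P :=
    { carrier := {f | ∀ p h : P, B (f * p) h ∈ L}
      add_mem' := fun {a b} ha hb p h => by
        rw [add_mul, map_add, LinearMap.add_apply]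
        exact L.add_mem (ha p h) (hb p h)
      zero_mem' := fun p h => by simp
      smul_mem' := fun c f hf p h => by
        have e : c • f * p = f * (c * p) := by rw [smul_eq_mul]; ring
        rw [e]
        exact hf _ h }
  have hJ : ∀ f : P, ∀ u ∈ J, B f u ∈ J := by
    intro f u hu p h
    have e : B f u * p = B f (u * p) - u * B f p := by
      rw [hleibniz]; ring
    have hup : B f (u * p) ∈ L := by
      rw [hanti]
      exact L.neg_mem (hu p f)
    rw [e, map_sub, LinearMap.sub_apply]
    exact L.sub_mem (hL' _ hup h) (hu _ h)
  rcases hsimple J hJ with hbot | htop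
  · left
    intro u hu
    refine bracket_eq_zero_of_bracket_bracket_eq_zero B hleibniz fun a => ?_
    have hv : B u a ∈ L := hL' u hu a
    have hmem : B u (B u a) ∈ J := by
      intro p h
      have e : B u (B u a) * p = B u (B u a * p) - B u a * B u p := by
        rw [hleibniz]; ring
      rw [e, map_sub, LinearMap.sub_apply]
      refine L.sub_mem (hL' _ (hL' u hu _) h) ?_
      exact bracket_mul_mem_of_forall_bracket_mem B hanti hleibniz L (hL' _ hv)
        (hL' _ (hL' u hu p)) h
    rw [hbot] at hmem
    exact (Submodule.mem_bot P).mp hmem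
  · right
    rw [Submodule.span_le]
    rintro _ ⟨a, b, rfl⟩
    have h1 : (1 : P) ∈ J := htop ▸ Submodule.mem_top
    simpa using h1 a b
end

section
/- On ℝ[x,y,z] with the Lie–Poisson bracket of sl(2,ℝ)*, there do not exist finitely many polynomials g_1,h_1,…,g_N,h_N ∈ ℝ[x,y,z] and p ∈ ℝ[x,y,z] such that {g_1,h_1} + ⋯ + {g_N,h_N} = 1 + p·(x² + y² − z² − 1). In other words, the constant 1 is not a sum of Poisson brackets modulo the ideal generated by x² + y² − z² − 1. -/
open MvPolynomial

/-- The Lie–Poisson bracket of `sl(2,ℝ)*` on `ℝ[x,y,z]`, with `x = X 0`, `y = X 1`,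
`z = X 2`: it satisfies `{y,z} = x`, `{z,x} = y`, `{x,y} = -z`. -/
noncomputable def sl2Bracket (f g : MvPolynomial (Fin 3) ℝ) : MvPolynomial (Fin 3) ℝ :=
  X 0 * (pderiv 1 f * pderiv 2 g - pderiv 2 f * pderiv 1 g)
    + X 1 * (pderiv 2 f * pderiv 0 g - pderiv 0 f * pderiv 2 g)
    - X 2 * (pderiv 0 f * pderiv 1 g - pderiv 1 f * pderiv 0 g)

/-- Moments of a (formal) Gaussian variable of variance `ε`. -/
def gaussianMoment (ε : ℝ) : ℕ → ℝ
  | 0 => 1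
  | 1 => 0
  | n + 2 => ε * (n + 1) * gaussianMoment ε n

lemma gaussianMoment_succ (ε : ℝ) (n : ℕ) :
    gaussianMoment ε (n + 1) = ε * n * gaussianMoment ε (n - 1) := by
  cases n with
  | zero => simp [gaussianMoment]
  | succ n => simp [gaussianMoment]

/-- The average of `x ^ s 0 * y ^ s 1 * z ^ s 2` over the compact real form
`(x, y, -iz) ∈ S²` of the complexified hyperboloid. -/
noncomputable def sphereMoment (s : Fin 3 →₀ ℕ) : ℝ :=
  gaussianMoment 1 (s 0) * gaussianMoment 1 (s 1) * gaussianMoment (-1) (s 2) /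
    ((s 0 + s 1 + s 2 + 1).doubleFactorial : ℝ)

/-- The average of a polynomial over the compact real form of the complexified hyperboloid. -/
noncomputable def sphereMean : MvPolynomial (Fin 3) ℝ →ₗ[ℝ] ℝ :=
  (basisMonomials (Fin 3) ℝ).constr ℝ sphereMoment

lemma sphereMean_monomial (s : Fin 3 →₀ ℕ) (r : ℝ) :
    sphereMean (monomial s r) = r * sphereMoment s := by
  have h : monomial s r = r • basisMonomials (Fin 3) ℝ s := by
    simp [smul_monomial]
  rw [h, map_smul, sphereMean, Module.Basis.constr_basis, smul_eq_mul]

lemma sphereMean_one : sphereMean 1 = 1 := by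
  rw [← C_1, C_apply, sphereMean_monomial]
  simp [sphereMoment, gaussianMoment]

/-- The mean vanishes on the ideal of the hyperboloid. -/
lemma sphereMean_mul_casimir (p : MvPolynomial (Fin 3) ℝ) :
    sphereMean (p * (X 0 ^ 2 + X 1 ^ 2 - X 2 ^ 2 - 1)) = 0 := by
  induction p using MvPolynomial.induction_on' with
  | add p q hp hq => rw [add_mul, map_add, hp, hq, add_zero]
  | monomial s r =>
    have hD (n : ℕ) : ((n.doubleFactorial : ℕ) : ℝ) ≠ 0 :=
      Nat.cast_ne_zero.2 (Nat.doubleFactorial_pos n).ne'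
    simp only [mul_sub, mul_add, mul_one, X_pow_eq_monomial, monomial_mul, map_sub, map_add,
      sphereMean_monomial, sphereMoment, Finsupp.add_apply, Finsupp.single_apply]
    generalize s 0 = a
    generalize s 1 = b
    generalize s 2 = c
    have h₁ : a + 2 + b + c + 1 = (a + b + c + 1) + 2 := by ring
    have h₂ : a + (b + 2) + c + 1 = (a + b + c + 1) + 2 := by ring
    have h₃ : a + b + (c + 2) + 1 = (a + b + c + 1) + 2 := by ring
    simp [h₁, h₂, h₃, gaussianMoment]
    have := hD (a + b + c + 1)
    have : (a + b + c + 1 + 2 : ℝ) ≠ 0 := by positivity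
    field_simp
    ring

lemma sphereMean_X_mul_pderiv_one_two (g : MvPolynomial (Fin 3) ℝ) :
    sphereMean (X 1 * pderiv 2 g) = -sphereMean (X 2 * pderiv 1 g) := by
  induction g using MvPolynomial.induction_on' with
  | add p q hp hq => simp only [map_add, mul_add, hp, hq, neg_add]
  | monomial s r =>
    simp only [pderiv_monomial, X, monomial_mul, sphereMean_monomial, sphereMoment,
      Finsupp.add_apply, Finsupp.tsub_apply, Finsupp.single_apply]
    generalize s 0 = a
    generalize s 1 = b
    generalize s 2 = c
    obtain ⟨D, hD⟩ : ∃ D : ℕ → ℝ, ∀ n : ℕ, (n.doubleFactorial : ℝ) = D n := ⟨_, fun _ => rfl⟩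
    simp only [hD]
    rcases b with _ | b <;> rcases c with _ | c <;>
      simp [gaussianMoment_succ, add_comm 1]
    ring_nf

lemma sphereMean_X_mul_pderiv_zero_two (g : MvPolynomial (Fin 3) ℝ) :
    sphereMean (X 0 * pderiv 2 g) = -sphereMean (X 2 * pderiv 0 g) := by
  induction g using MvPolynomial.induction_on' with
  | add p q hp hq => simp only [map_add, mul_add, hp, hq, neg_add]
  | monomial s r =>
    simp only [pderiv_monomial, X, monomial_mul, sphereMean_monomial, sphereMoment,
      Finsupp.add_apply, Finsupp.tsub_apply, Finsupp.single_apply]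
    generalize s 0 = a
    generalize s 1 = b
    generalize s 2 = c
    obtain ⟨D, hD⟩ : ∃ D : ℕ → ℝ, ∀ n : ℕ, (n.doubleFactorial : ℝ) = D n := ⟨_, fun _ => rfl⟩
    simp only [hD]
    rcases a with _ | a <;> rcases c with _ | c <;>
      simp [gaussianMoment_succ, add_comm 1]
    ring_nf

lemma sphereMean_X_mul_pderiv_zero_one (g : MvPolynomial (Fin 3) ℝ) :
    sphereMean (X 0 * pderiv 1 g) = sphereMean (X 1 * pderiv 0 g) := by
  induction g using MvPolynomial.induction_on' with
  | add p q hp hq => simp only [map_add, mul_add, hp, hq]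
  | monomial s r =>
    simp only [pderiv_monomial, X, monomial_mul, sphereMean_monomial, sphereMoment,
      Finsupp.add_apply, Finsupp.tsub_apply, Finsupp.single_apply]
    generalize s 0 = a
    generalize s 1 = b
    generalize s 2 = c
    obtain ⟨D, hD⟩ : ∃ D : ℕ → ℝ, ∀ n : ℕ, (n.doubleFactorial : ℝ) = D n := ⟨_, fun _ => rfl⟩
    simp only [hD]
    rcases a with _ | a <;> rcases b with _ | b <;>
      simp [gaussianMoment_succ, add_comm 1]
    ring_nf

lemma sphereMean_sl2Bracket_X (i : Fin 3) (g : MvPolynomial (Fin 3) ℝ) :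
    sphereMean (sl2Bracket (X i) g) = 0 := by
  have h₁ := sphereMean_X_mul_pderiv_one_two g
  have h₂ := sphereMean_X_mul_pderiv_zero_two g
  have h₃ := sphereMean_X_mul_pderiv_zero_one g
  fin_cases i <;> simp [sl2Bracket, pderiv_X] <;> linarith

lemma sphereMean_sl2Bracket (f g : MvPolynomial (Fin 3) ℝ) :
    sphereMean (sl2Bracket f g) = 0 := by
  induction f using MvPolynomial.induction_on generalizing g with
  | C r => simp [sl2Bracket]
  | add p q hp hq =>
    have h : sl2Bracket (p + q) g = sl2Bracket p g + sl2Bracket q g := by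
      simp only [sl2Bracket, map_add]
      ring
    rw [h, map_add, hp, hq, add_zero]
  | mul_X p i hp =>
    have h : sl2Bracket (p * X i) g = sl2Bracket p (X i * g) + sl2Bracket (X i) (p * g) := by
      simp only [sl2Bracket, pderiv_mul]
      ring
    rw [h, map_add, hp, sphereMean_sl2Bracket_X, add_zero]

/-- On `ℝ[x,y,z]` with the Lie–Poisson bracket of `sl(2,ℝ)*`, the constant
`1` is not a finite sum of Poisson brackets modulo the ideal generated by
`x² + y² − z² − 1`. -/
theorem one_not_sum_of_brackets_mod_hyperboloid :
    ¬ ∃ (N : ℕ) (g h : Fin N → MvPolynomial (Fin 3) ℝ) (p : MvPolynomial (Fin 3) ℝ),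
      (∑ j, sl2Bracket (g j) (h j)) =
        1 + p * (X 0 ^ 2 + X 1 ^ 2 - X 2 ^ 2 - 1) := by
  rintro ⟨N, g, h, p, hp⟩
  have := congrArg sphereMean hp
  simp [map_sum, sphereMean_sl2Bracket, sphereMean_one, sphereMean_mul_casimir] at this
end

section
/- On ℝ[x,y,z] with the Lie–Poisson bracket of sl(2,ℝ)*, every polynomial f ∈ ℝ[x,y,z] can be written as f = r·1 + {g_1,h_1} + ⋯ + {g_N,h_N} + p·(x² + y² − z² − 1) for some real number r, finitely many polynomials g_j, h_j ∈ ℝ[x,y,z], and some p ∈ ℝ[x,y,z]. -/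
open MvPolynomial

/-- The subspace of polynomials that are a constant plus a sum of Poisson brackets plus a multiple
of `x² + y² − z² − 1`. -/
noncomputable def constAddBrackets : Submodule ℝ (MvPolynomial (Fin 3) ℝ) :=
  (Submodule.span ℝ {1} ⊔ Submodule.span ℝ {q | ∃ g h, q = sl2Bracket g h}) ⊔
    (Ideal.span {(X 0 ^ 2 + X 1 ^ 2 - X 2 ^ 2 - 1 : MvPolynomial (Fin 3) ℝ)}).restrictScalars ℝ

theorem one_mem_constAddBrackets : 1 ∈ constAddBrackets :=
  Submodule.mem_sup_left (Submodule.mem_sup_left (Submodule.mem_span_singleton_self 1))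

theorem sl2Bracket_mem_constAddBrackets (g h : MvPolynomial (Fin 3) ℝ) :
    sl2Bracket g h ∈ constAddBrackets :=
  Submodule.mem_sup_left (Submodule.mem_sup_right (Submodule.subset_span ⟨g, h, rfl⟩))

theorem mul_hyperboloid_mem_constAddBrackets (p : MvPolynomial (Fin 3) ℝ) :
    p * (X 0 ^ 2 + X 1 ^ 2 - X 2 ^ 2 - 1) ∈ constAddBrackets :=
  Submodule.mem_sup_right (Ideal.mul_mem_left _ p (Ideal.mem_span_singleton_self _))

theorem sl2Bracket_smul_left (r : ℝ) (g h : MvPolynomial (Fin 3) ℝ) :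
    sl2Bracket (r • g) h = r • sl2Bracket g h := by
  simp only [sl2Bracket, Derivation.map_smul]
  simp only [smul_eq_C_mul]
  ring

theorem sl2Bracket_X_two_monomial (a b c : ℕ) :
    sl2Bracket (X 2) (X 0 ^ a * X 1 ^ b * X 2 ^ c) =
      (a : MvPolynomial (Fin 3) ℝ) * X 0 ^ (a - 1) * X 1 ^ (b + 1) * X 2 ^ c -
        (b : MvPolynomial (Fin 3) ℝ) * X 0 ^ (a + 1) * X 1 ^ (b - 1) * X 2 ^ c := by
  simp [sl2Bracket, pderiv_X, Derivation.leibniz, Derivation.leibniz_pow]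
  ring

theorem sl2Bracket_X_one_monomial (a b c : ℕ) :
    sl2Bracket (X 1) (X 0 ^ a * X 1 ^ b * X 2 ^ c) =
      (a : MvPolynomial (Fin 3) ℝ) * X 0 ^ (a - 1) * X 1 ^ b * X 2 ^ (c + 1) +
        (c : MvPolynomial (Fin 3) ℝ) * X 0 ^ (a + 1) * X 1 ^ b * X 2 ^ (c - 1) := by
  simp [sl2Bracket, pderiv_X, Derivation.leibniz, Derivation.leibniz_pow]
  ring

theorem mem_constAddBrackets_of_natCast_mul {n : ℕ} (hn : n ≠ 0) {p : MvPolynomial (Fin 3) ℝ}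
    (hp : n * p ∈ constAddBrackets) : p ∈ constAddBrackets := by
  rw [← nsmul_eq_mul, ← Nat.cast_smul_eq_nsmul ℝ] at hp
  exact (Submodule.smul_mem_iff _ (Nat.cast_ne_zero.mpr hn)).mp hp

theorem natCast_mul_mem_constAddBrackets (n : ℕ) {p : MvPolynomial (Fin 3) ℝ}
    (hp : p ∈ constAddBrackets) : n * p ∈ constAddBrackets := by
  rw [← nsmul_eq_mul]
  exact nsmul_mem hp n

theorem monomial_add_two_left_mem {a b c : ℕ}
    (h : X 0 ^ a * X 1 ^ b * X 2 ^ c ∈ constAddBrackets) :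
    X 0 ^ (a + 2) * X 1 ^ b * X 2 ^ c ∈ constAddBrackets := by
  apply mem_constAddBrackets_of_natCast_mul (n := a + b + c + 3) (by omega)
  convert sub_mem (add_mem (add_mem
    (mul_hyperboloid_mem_constAddBrackets (((a : MvPolynomial (Fin 3) ℝ) + 1) *
      (X 0 ^ a * X 1 ^ b * X 2 ^ c)))
    (natCast_mul_mem_constAddBrackets (a + 1) h))
    (sl2Bracket_mem_constAddBrackets (X 1) (X 0 ^ (a + 1) * X 1 ^ b * X 2 ^ (c + 1))))
    (sl2Bracket_mem_constAddBrackets (X 2) (X 0 ^ (a + 1) * X 1 ^ (b + 1) * X 2 ^ c)) using 1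
  simp only [sl2Bracket_X_one_monomial, sl2Bracket_X_two_monomial, Nat.add_sub_cancel]
  push_cast
  ring

theorem monomial_add_two_middle_mem {a b c : ℕ}
    (h : X 0 ^ a * X 1 ^ b * X 2 ^ c ∈ constAddBrackets) :
    X 0 ^ a * X 1 ^ (b + 2) * X 2 ^ c ∈ constAddBrackets := by
  apply mem_constAddBrackets_of_natCast_mul (n := a + 1) (by omega)
  convert add_mem (natCast_mul_mem_constAddBrackets (b + 1) (monomial_add_two_left_mem h))
    (sl2Bracket_mem_constAddBrackets (X 2) (X 0 ^ (a + 1) * X 1 ^ (b + 1) * X 2 ^ c)) using 1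
  simp only [sl2Bracket_X_two_monomial, Nat.add_sub_cancel]
  push_cast
  ring

theorem monomial_add_two_right_mem {a b c : ℕ}
    (h : X 0 ^ a * X 1 ^ b * X 2 ^ c ∈ constAddBrackets) :
    X 0 ^ a * X 1 ^ b * X 2 ^ (c + 2) ∈ constAddBrackets := by
  apply mem_constAddBrackets_of_natCast_mul (n := a + 1) (by omega)
  convert sub_mem
    (sl2Bracket_mem_constAddBrackets (X 1) (X 0 ^ (a + 1) * X 1 ^ b * X 2 ^ (c + 1)))
    (natCast_mul_mem_constAddBrackets (c + 1) (monomial_add_two_left_mem h)) using 1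
  simp only [sl2Bracket_X_one_monomial, Nat.add_sub_cancel]
  push_cast
  ring

theorem monomial_mem_constAddBrackets :
    ∀ a b c : ℕ, X 0 ^ a * X 1 ^ b * X 2 ^ c ∈ constAddBrackets
  | a + 2, b, c => monomial_add_two_left_mem (monomial_mem_constAddBrackets a b c)
  | a, b + 2, c => monomial_add_two_middle_mem (monomial_mem_constAddBrackets a b c)
  | a, b, c + 2 => monomial_add_two_right_mem (monomial_mem_constAddBrackets a b c)
  | 1, b, c => by
    apply mem_constAddBrackets_of_natCast_mul (n := b + 1) (by omega)
    convert neg_mem (sl2Bracket_mem_constAddBrackets (X 2) (X 0 ^ 0 * X 1 ^ (b + 1) * X 2 ^ c))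
      using 1
    simp only [sl2Bracket_X_two_monomial, Nat.add_sub_cancel]
    push_cast
    ring
  | 0, 1, c => by
    convert sl2Bracket_mem_constAddBrackets (X 2) (X 0 ^ 1 * X 1 ^ 0 * X 2 ^ c) using 1
    rw [sl2Bracket_X_two_monomial]
    simp
  | 0, 0, 1 => by
    convert sl2Bracket_mem_constAddBrackets (X 1) (X 0 ^ 1 * X 1 ^ 0 * X 2 ^ 0) using 1
    rw [sl2Bracket_X_one_monomial]
    simp
  | 0, 0, 0 => by simpa using one_mem_constAddBrackets

theorem constAddBrackets_eq_top : constAddBrackets = ⊤ := by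
  refine Submodule.eq_top_iff'.mpr fun f => ?_
  induction f using MvPolynomial.induction_on' with
  | monomial s r =>
    have hs := Submodule.smul_mem _ r (monomial_mem_constAddBrackets (s 0) (s 1) (s 2))
    rwa [smul_eq_C_mul, ← Fin.prod_univ_three fun i => (X i : MvPolynomial (Fin 3) ℝ) ^ s i,
      ← Finsupp.prod_fintype s _ fun i => pow_zero (X i : MvPolynomial (Fin 3) ℝ),
      ← monomial_eq] at hs
  | add p q hp hq => exact add_mem hp hq

/-- On `ℝ[x,y,z]` with the Lie–Poisson bracket of `sl(2,ℝ)*`, every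
polynomial is a real constant plus a finite sum of Poisson brackets plus a multiple of
`x² + y² − z² − 1`. -/
theorem poly_eq_const_add_brackets_mod_hyperboloid
    (f : MvPolynomial (Fin 3) ℝ) :
    ∃ (r : ℝ) (N : ℕ) (g h : Fin N → MvPolynomial (Fin 3) ℝ)
      (p : MvPolynomial (Fin 3) ℝ),
      f = C r + (∑ j, sl2Bracket (g j) (h j))
            + p * (X 0 ^ 2 + X 1 ^ 2 - X 2 ^ 2 - 1) := by
  have hf : f ∈ constAddBrackets := constAddBrackets_eq_top ▸ Submodule.mem_top
  obtain ⟨u, hu, v, hv, rfl⟩ := Submodule.mem_sup.mp hf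
  obtain ⟨s, hs, t, ht, rfl⟩ := Submodule.mem_sup.mp hu
  obtain ⟨r, rfl⟩ := Submodule.mem_span_singleton.mp hs
  obtain ⟨p, rfl⟩ := Ideal.mem_span_singleton'.mp hv
  obtain ⟨N, w, q, rfl⟩ := Submodule.mem_span_set'.mp ht
  choose g h hgh using fun j => (q j).2
  exact ⟨r, N, fun j => w j • g j, h, p, by
    simp only [sl2Bracket_smul_left, hgh]
    rw [smul_eq_C_mul, mul_one]⟩
end

section
/- On ℝ[x,y,z] with the Lie–Poisson bracket of sl(2,ℝ)*, let J be an ideal of the commutative ring ℝ[x,y,z] which is also a Lie ideal ({f, u} ∈ J for all f ∈ ℝ[x,y,z], u ∈ J), and suppose J contains the polynomial x² + y² − z² − 1. Then either J equals the ideal generated by x² + y² − z² − 1, or J = ℝ[x,y,z]. -/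
open MvPolynomial

/-- The Hamiltonian derivation `g ↦ {f, g}`. -/
noncomputable def sl2Derivation (f : MvPolynomial (Fin 3) ℝ) :
    Derivation ℝ (MvPolynomial (Fin 3) ℝ) (MvPolynomial (Fin 3) ℝ) :=
  (X 1 * pderiv 2 f + X 2 * pderiv 1 f) • pderiv 0
    - (X 0 * pderiv 2 f + X 2 * pderiv 0 f) • pderiv 1
    + (X 0 * pderiv 1 f - X 1 * pderiv 0 f) • pderiv 2

theorem sl2Derivation_apply (f g : MvPolynomial (Fin 3) ℝ) :
    sl2Derivation f g = sl2Bracket f g := by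
  simp only [sl2Derivation, sl2Bracket, Derivation.add_apply, Derivation.sub_apply,
    Derivation.smul_apply, smul_eq_mul]
  ring

/-- The weight vectors of `{y, ·}`: `(x + z) ^ a` for `a ≥ 0` and `(x - z) ^ (-a)` for `a ≤ 0`. -/
noncomputable def weightVector (a : ℤ) : MvPolynomial (Fin 3) ℝ :=
  (X 0 + X 2) ^ a.toNat * (X 0 - X 2) ^ (-a).toNat

theorem sl2Derivation_X_one_weightVector (a : ℤ) :
    sl2Derivation (X 1) (weightVector a) = (a : ℝ) • weightVector a := by
  have hu : sl2Derivation (X 1) (X 0 + X 2) = X 0 + X 2 := by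
    rw [sl2Derivation_apply]; simp [sl2Bracket, pderiv_X]
  have hv : sl2Derivation (X 1) (X 0 - X 2) = -(X 0 - X 2) := by
    rw [sl2Derivation_apply]; simp [sl2Bracket, pderiv_X]; ring
  obtain ⟨n, rfl | rfl⟩ := a.eq_nat_or_neg
  · rcases n with _ | n
    · simp [weightVector]
    · simp only [weightVector, Int.toNat_natCast, Int.toNat_neg_natCast, pow_zero, mul_one,
        Derivation.leibniz_pow, hu, Nat.add_sub_cancel, smul_eq_mul, MvPolynomial.smul_eq_C_mul,
        nsmul_eq_mul]
      simp only [Int.cast_natCast, map_natCast]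
      ring
  · rcases n with _ | n
    · simp [weightVector]
    · simp only [weightVector, neg_neg, Int.toNat_natCast, Int.toNat_neg_natCast, pow_zero, one_mul,
        Derivation.leibniz_pow, hv, Nat.add_sub_cancel, smul_eq_mul, MvPolynomial.smul_eq_C_mul,
        nsmul_eq_mul]
      simp only [Int.cast_neg, Int.cast_natCast, map_neg, map_natCast]
      ring

theorem sl2Derivation_aeval (f : MvPolynomial (Fin 3) ℝ) (p : Polynomial ℝ) :
    sl2Derivation f (Polynomial.aeval (X 1) p) =
      Polynomial.aeval (X 1) p.derivative * sl2Bracket f (X 1) := by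
  rw [Derivation.map_aeval, smul_eq_mul, sl2Derivation_apply]

/-- `∑ a, weightVector a * F a (y)`, as a linear function of `F`. -/
noncomputable def weightSum : (ℤ →₀ Polynomial ℝ) →ₗ[ℝ] MvPolynomial (Fin 3) ℝ :=
  Finsupp.lsum ℝ fun a =>
    LinearMap.mulLeft ℝ (weightVector a) ∘ₗ (Polynomial.aeval (X 1)).toLinearMap

theorem weightSum_single (a : ℤ) (p : Polynomial ℝ) :
    weightSum (Finsupp.single a p) = weightVector a * Polynomial.aeval (X 1) p := by
  simp [weightSum]

theorem weightSum_eq_sum (F : ℤ →₀ Polynomial ℝ) :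
    weightSum F = ∑ a ∈ F.support, weightVector a * Polynomial.aeval (X 1) (F a) := by
  simp [weightSum, Finsupp.sum]

local notation "hyp" => (X 0 ^ 2 + X 1 ^ 2 - X 2 ^ 2 - 1 : MvPolynomial (Fin 3) ℝ)

theorem exists_weightSum_mul_add (F : ℤ →₀ Polynomial ℝ) :
    ∃ G, hyp ∣ weightSum F * (X 0 + X 2) - weightSum G := by
  induction F using Finsupp.induction_linear with
  | zero => exact ⟨0, by simp⟩
  | add F₁ F₂ h₁ h₂ =>
    obtain ⟨G₁, h₁⟩ := h₁
    obtain ⟨G₂, h₂⟩ := h₂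
    refine ⟨G₁ + G₂, ?_⟩
    convert dvd_add h₁ h₂ using 1
    simp only [map_add]
    ring
  | single a p =>
    obtain ⟨n, rfl | rfl⟩ := a.eq_nat_or_neg
    · refine ⟨Finsupp.single ((n + 1 : ℕ) : ℤ) p, 0, ?_⟩
      simp only [weightSum_single, weightVector, Int.toNat_natCast, Int.toNat_neg_natCast]
      ring
    · rcases n with _ | n
      · refine ⟨Finsupp.single 1 p, 0, ?_⟩
        simp [weightSum_single, weightVector]
        ring
      · refine ⟨Finsupp.single (-(n : ℤ)) (p * (1 - Polynomial.X ^ 2)),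
          (X 0 - X 2) ^ n * Polynomial.aeval (X 1) p, ?_⟩
        simp only [weightSum_single, weightVector, neg_neg, Int.toNat_natCast,
          Int.toNat_neg_natCast, map_mul, map_sub, map_pow, map_one, Polynomial.aeval_X]
        ring

theorem exists_weightSum_mul_sub (F : ℤ →₀ Polynomial ℝ) :
    ∃ G, hyp ∣ weightSum F * (X 0 - X 2) - weightSum G := by
  induction F using Finsupp.induction_linear with
  | zero => exact ⟨0, by simp⟩
  | add F₁ F₂ h₁ h₂ =>
    obtain ⟨G₁, h₁⟩ := h₁
    obtain ⟨G₂, h₂⟩ := h₂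
    refine ⟨G₁ + G₂, ?_⟩
    convert dvd_add h₁ h₂ using 1
    simp only [map_add]
    ring
  | single a p =>
    obtain ⟨n, rfl | rfl⟩ := a.eq_nat_or_neg
    · rcases n with _ | n
      · refine ⟨Finsupp.single (-1) p, 0, ?_⟩
        simp [weightSum_single, weightVector]
        ring
      · refine ⟨Finsupp.single (n : ℤ) (p * (1 - Polynomial.X ^ 2)),
          (X 0 + X 2) ^ n * Polynomial.aeval (X 1) p, ?_⟩
        simp only [weightSum_single, weightVector, Int.toNat_natCast,
          Int.toNat_neg_natCast, map_mul, map_sub, map_pow, map_one, Polynomial.aeval_X]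
        ring
    · refine ⟨Finsupp.single (-((n + 1 : ℕ) : ℤ)) p, 0, ?_⟩
      simp only [weightSum_single, weightVector, neg_neg, Int.toNat_natCast,
        Int.toNat_neg_natCast]
      ring

theorem exists_weightSum_mul_X_one (F : ℤ →₀ Polynomial ℝ) :
    ∃ G, weightSum F * X 1 = weightSum G := by
  induction F using Finsupp.induction_linear with
  | zero => exact ⟨0, by simp⟩
  | add F₁ F₂ h₁ h₂ =>
    obtain ⟨G₁, h₁⟩ := h₁
    obtain ⟨G₂, h₂⟩ := h₂
    exact ⟨G₁ + G₂, by rw [map_add, map_add, add_mul, h₁, h₂]⟩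
  | single a p =>
    exact ⟨Finsupp.single a (p * Polynomial.X), by
      simp only [weightSum_single, map_mul, Polynomial.aeval_X, mul_assoc]⟩

/-- Modulo `x² + y² - z² - 1`, every polynomial is a sum of weight vectors. -/
theorem exists_dvd_sub_weightSum (f : MvPolynomial (Fin 3) ℝ) :
    ∃ F, hyp ∣ f - weightSum F := by
  induction f using MvPolynomial.induction_on with
  | C r =>
    refine ⟨Finsupp.single 0 (Polynomial.C r), 0, ?_⟩
    simp [weightSum_single, weightVector, MvPolynomial.algebraMap_eq]
  | add f g hf hg =>
    obtain ⟨F, hF⟩ := hf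
    obtain ⟨G, hG⟩ := hg
    refine ⟨F + G, ?_⟩
    convert dvd_add hF hG using 1
    rw [map_add]
    ring
  | mul_X f i hf =>
    obtain ⟨F, k, hF⟩ := hf
    obtain ⟨U, k₁, hU⟩ := exists_weightSum_mul_add F
    obtain ⟨V, k₂, hV⟩ := exists_weightSum_mul_sub F
    have h2 : (C (1 / 2) : MvPolynomial (Fin 3) ℝ) * 2 = 1 := by
      rw [← map_ofNat (C : ℝ →+* MvPolynomial (Fin 3) ℝ) 2, ← map_mul]
      norm_num
    fin_cases i
    · refine ⟨(1 / 2 : ℝ) • (U + V), k * X 0 + C (1 / 2) * (k₁ + k₂), ?_⟩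
      simp only [map_smul, map_add, MvPolynomial.smul_eq_C_mul, Fin.zero_eta]
      linear_combination X 0 * hF + C (1 / 2) * (hU + hV) - weightSum F * X 0 * h2
    · obtain ⟨G, hG⟩ := exists_weightSum_mul_X_one F
      refine ⟨G, k * X 1, ?_⟩
      simp only [Fin.mk_one]
      linear_combination X 1 * hF + hG
    · refine ⟨(1 / 2 : ℝ) • (U - V), k * X 2 + C (1 / 2) * (k₁ - k₂), ?_⟩
      simp only [map_smul, map_sub, MvPolynomial.smul_eq_C_mul, Fin.reduceFinMk]
      linear_combination X 2 * hF + C (1 / 2) * (hU - hV) - weightSum F * X 2 * h2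

/-- A subspace stable under an endomorphism contains the components of its elements along
eigenvectors with distinct eigenvalues. -/
theorem mem_of_sum_eigenvectors_mem {M : Type*} [AddCommGroup M] [Module ℝ M]
    (N : Submodule ℝ M) (D : M →ₗ[ℝ] M) (hD : ∀ m ∈ N, D m ∈ N) (t : Finset ℤ) (c : ℤ → M)
    (hc : ∀ a, D (c a) = (a : ℝ) • c a) (ht : ∑ a ∈ t, c a ∈ N) {a : ℤ} (ha : a ∈ t) :
    c a ∈ N := by
  classical
  have key : ∀ s : Finset ℤ, ∑ b ∈ t, (∏ i ∈ s, ((b : ℝ) - i)) • c b ∈ N := by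
    intro s
    induction s using Finset.induction_on with
    | empty => simpa using ht
    | insert i s hi ih =>
      convert N.sub_mem (hD _ ih) (N.smul_mem (i : ℝ) ih) using 1
      rw [map_sum, Finset.smul_sum, ← Finset.sum_sub_distrib]
      refine Finset.sum_congr rfl fun b _ => ?_
      rw [Finset.prod_insert hi, map_smul, hc]
      module
  have h := key (t.erase a)
  rw [Finset.sum_eq_single a] at h
  · refine (N.smul_mem_iff ?_).1 h
    refine Finset.prod_ne_zero_iff.2 fun i hi => sub_ne_zero.2 ?_
    exact_mod_cast (Finset.ne_of_mem_erase hi).symm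
  · intro b hb hba
    have h0 : ∏ i ∈ t.erase a, ((b : ℝ) - i) = 0 :=
      Finset.prod_eq_zero (Finset.mem_erase.2 ⟨hba, hb⟩) (sub_self _)
    rw [h0, zero_smul]
  · exact fun hn => absurd ha hn

theorem hyp_dvd_weightVector_neg_mul (a : ℤ) :
    hyp ∣ weightVector (-a) * weightVector a - (1 - X 1 ^ 2) ^ a.natAbs := by
  have h : weightVector (-a) * weightVector a =
      ((X 0 + X 2) * (X 0 - X 2) : MvPolynomial (Fin 3) ℝ) ^ a.natAbs := by
    obtain ⟨n, rfl | rfl⟩ := a.eq_nat_or_neg <;> simp [weightVector, mul_pow, mul_comm]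
  rw [h]
  refine dvd_trans ?_ (sub_dvd_pow_sub_pow _ _ _)
  exact ⟨1, by ring⟩

/-- A nonzero ideal of `ℝ[y]` stable under `q ↦ (1 - y²) dq/dy` and under the Legendre operator
`q ↦ d/dy ((1 - y²) dq/dy)` is the whole ring. -/
theorem Polynomial.ideal_eq_top_of_legendre (I : Ideal (Polynomial ℝ)) (hI : I ≠ ⊥)
    (h₁ : ∀ q ∈ I, (1 - Polynomial.X ^ 2) * q.derivative ∈ I)
    (h₂ : ∀ q ∈ I, ((1 - Polynomial.X ^ 2) * q.derivative).derivative ∈ I) : I = ⊤ := by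
  obtain ⟨q, rfl⟩ := (IsPrincipalIdealRing.principal I).principal
  have hq : q ≠ 0 := fun h => hI (by simp [h])
  have hmem : q ∈ Ideal.span {q} := Ideal.mem_span_singleton_self q
  obtain ⟨h, hh⟩ := Ideal.mem_span_singleton.1 (h₁ q hmem)
  obtain ⟨l, hl⟩ := Ideal.mem_span_singleton.1 (h₂ q hmem)
  rw [hh, Polynomial.derivative_mul] at hl
  have hsq : h ^ 2 = (1 - Polynomial.X ^ 2) * (l - h.derivative) := by
    refine mul_left_cancel₀ hq ?_
    linear_combination (1 - Polynomial.X ^ 2) * hl - h * hh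
  have hroot : ∀ r : ℝ, r ^ 2 = 1 → Polynomial.X - Polynomial.C r ∣ h := fun r hr => by
    have := congrArg (Polynomial.eval r) hsq
    rw [Polynomial.dvd_iff_isRoot]
    simpa [hr] using this
  have hdvd : 1 - Polynomial.X ^ 2 ∣ h := by
    have hcop := Polynomial.isCoprime_X_sub_C_of_isUnit_sub
      (R := ℝ) (a := 1) (b := -1) (by norm_num)
    refine dvd_trans ⟨-1, ?_⟩ (hcop.mul_dvd (hroot 1 (by norm_num)) (hroot (-1) (by norm_num)))
    simp
    ring
  obtain ⟨m, rfl⟩ := hdvd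
  have hX : (1 - Polynomial.X ^ 2 : Polynomial ℝ) ≠ 0 := fun h0 => by
    simpa using congrArg (Polynomial.eval 0) h0
  have hder : q ∣ q.derivative := ⟨m, mul_left_cancel₀ hX (by linear_combination hh)⟩
  have hzero : q.derivative = 0 := by
    by_contra hne
    exact absurd (Polynomial.degree_le_of_dvd hder hne)
      (not_le.2 (Polynomial.degree_derivative_lt hq))
  rw [Ideal.span_singleton_eq_top]
  rw [Polynomial.eq_C_of_derivative_eq_zero hzero] at hq ⊢
  exact Polynomial.isUnit_C.2 (isUnit_iff_ne_zero.2 fun h0 => hq (by rw [h0, map_zero]))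

/-- On `ℝ[x,y,z]` with the Lie–Poisson bracket of `sl(2,ℝ)*`, every
Poisson ideal `J` (an ideal that is also a Lie ideal) containing `x² + y² − z² − 1`
is either the ideal generated by `x² + y² − z² − 1` or the whole ring. -/
theorem poisson_ideal_above_hyperboloid
    (J : Ideal (MvPolynomial (Fin 3) ℝ))
    (hJlie : ∀ f : MvPolynomial (Fin 3) ℝ, ∀ u ∈ J, sl2Bracket f u ∈ J)
    (hJC : (X 0 ^ 2 + X 1 ^ 2 - X 2 ^ 2 - 1 : MvPolynomial (Fin 3) ℝ) ∈ J) :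
    J = Ideal.span {(X 0 ^ 2 + X 1 ^ 2 - X 2 ^ 2 - 1 : MvPolynomial (Fin 3) ℝ)} ∨
      J = ⊤ := by
  refine or_iff_not_imp_left.2 fun hne => ?_
  have hder : ∀ f, ∀ u ∈ J, sl2Derivation f u ∈ J := fun f u hu => by
    rw [sl2Derivation_apply]
    exact hJlie f u hu
  have hdvd : ∀ {f g}, hyp ∣ f - g → (f ∈ J ↔ g ∈ J) := fun h =>
    have hJ := J.mem_of_dvd h hJC
    ⟨fun hf => (J.sub_mem_iff_right hf).1 hJ, fun hg => (J.sub_mem_iff_left hg).1 hJ⟩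
  have hle : Ideal.span {hyp} ≤ J := (Ideal.span_singleton_le_iff_mem J).2 hJC
  obtain ⟨f, hfJ, hf⟩ := SetLike.exists_of_lt (lt_of_le_of_ne hle (Ne.symm hne))
  obtain ⟨F, hF⟩ := exists_dvd_sub_weightSum f
  have hFJ := (hdvd hF).1 hfJ
  have hF0 : F ≠ 0 := by
    rintro rfl
    exact hf (Ideal.mem_span_singleton.2 (by simpa using hF))
  obtain ⟨a, ha⟩ := Finsupp.support_nonempty_iff.2 hF0
  have hcomp : weightVector a * Polynomial.aeval (X 1) (F a) ∈ J := by
    rw [weightSum_eq_sum] at hFJ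
    refine mem_of_sum_eigenvectors_mem (J.restrictScalars ℝ)
      (sl2Derivation (X 1)).toLinearMap (hder _) F.support
      (fun b => weightVector b * Polynomial.aeval (X 1) (F b)) (fun b => ?_) hFJ ha
    have h0 : sl2Bracket (X 1) (X 1) = 0 := by simp [sl2Bracket, mul_comm]
    simp only [Derivation.coeFn_coe, Derivation.leibniz, sl2Derivation_aeval, h0,
      sl2Derivation_X_one_weightVector, smul_eq_mul, mul_zero, zero_add]
    rw [mul_smul_comm, mul_comm]
  let I := J.comap (Polynomial.aeval (R := ℝ) (X 1 : MvPolynomial (Fin 3) ℝ))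
  have hI : I ≠ ⊥ := by
    refine (Submodule.ne_bot_iff _).2 ⟨(1 - Polynomial.X ^ 2) ^ a.natAbs * F a, ?_, ?_⟩
    · have h := J.mul_mem_left (weightVector (-a)) hcomp
      rw [← mul_assoc] at h
      simpa [I] using (hdvd (by
        rw [← sub_mul]
        exact (hyp_dvd_weightVector_neg_mul a).mul_right _)).1 h
    · refine mul_ne_zero (pow_ne_zero _ fun h0 => ?_) (Finsupp.mem_support_iff.1 ha)
      simpa using congrArg (Polynomial.eval 0) h0
  have hu : sl2Bracket (X 0 + X 2) (X 1) = -(X 0 + X 2) := by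
    simp [sl2Bracket, pderiv_X]; ring
  have hv : sl2Bracket (X 0 - X 2) (X 1) = X 0 - X 2 := by
    simp [sl2Bracket, pderiv_X]
  have hvu : sl2Bracket (X 0 - X 2) (X 0 + X 2) = -2 * X 1 := by
    simp [sl2Bracket, pderiv_X]; ring
  have hu_mem : ∀ q ∈ I, (X 0 + X 2) * Polynomial.aeval (X 1) q.derivative ∈ J := fun q hq => by
    have h := J.neg_mem (hder (X 0 + X 2) _ hq)
    rw [sl2Derivation_aeval, hu] at h
    convert h using 1
    ring
  have hItop : I = ⊤ := by
    refine Polynomial.ideal_eq_top_of_legendre I hI (fun q hq => ?_) fun q hq => ?_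
    · refine (hdvd ?_).1 (J.mul_mem_left (X 0 - X 2) (hu_mem q hq))
      refine ⟨Polynomial.aeval (X 1) q.derivative, ?_⟩
      simp
      ring
    · refine (hdvd ?_).1 (hder (X 0 - X 2) _ (hu_mem q hq))
      refine ⟨Polynomial.aeval (X 1) q.derivative.derivative, ?_⟩
      rw [Derivation.leibniz, sl2Derivation_aeval, sl2Derivation_apply, hv, hvu]
      simp [Polynomial.derivative_mul]
      ring
  exact (Ideal.eq_top_iff_one J).2 (by simpa [I] using (Ideal.eq_top_iff_one I).1 hItop)
end

section
/- On ℝ[x,y,z] with the Lie–Poisson bracket of sl(2,ℝ)*, let M² be the ideal generated by the monomials x², y², z², xy, xz, yz, and let (C) be the ideal generated by C = x² + y² − z². Then: (a) {f, u} ∈ M² for all f ∈ ℝ[x,y,z] and u ∈ M²; (b) C ∈ M²; (c) the bracket {x, y} = −z does not lie in M², so M² does not contain the derived ideal; and (d) there exist u ∈ M² and f ∈ ℝ[x,y,z] with {u, f} ∉ (C) (e.g. {x², y} = −2xz ∉ (C)), so M² is not central modulo (C). Hence the image of M² in ℝ[x,y,z]/(C) is a Lie ideal that neither lies in the Lie center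 nor contains the derived ideal. -/
open MvPolynomial

/-- The Leibniz rule for the bracket in its second argument. -/
lemma sl2Bracket_mul_right (f g h : MvPolynomial (Fin 3) ℝ) :
    sl2Bracket f (g * h) = sl2Bracket f g * h + g * sl2Bracket f h := by
  simp only [sl2Bracket, Derivation.leibniz, smul_eq_mul]
  ring

lemma sl2Bracket_add_right (f g h : MvPolynomial (Fin 3) ℝ) :
    sl2Bracket f (g + h) = sl2Bracket f g + sl2Bracket f h := by
  simp only [sl2Bracket, map_add]
  ring

/-- Every bracket lies in the ideal of the origin. -/
lemma sl2Bracket_mem_span_X (f g : MvPolynomial (Fin 3) ℝ) :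
    sl2Bracket f g ∈ Ideal.span (Set.range (X : Fin 3 → MvPolynomial (Fin 3) ℝ)) := by
  have hX (i : Fin 3) : (X i : MvPolynomial (Fin 3) ℝ) ∈ Ideal.span (Set.range X) :=
    Ideal.subset_span ⟨i, rfl⟩
  exact sub_mem (add_mem (Ideal.mul_mem_right _ _ (hX 0)) (Ideal.mul_mem_right _ _ (hX 1)))
    (Ideal.mul_mem_right _ _ (hX 2))

/-- The degree two monomials generate the square of the ideal of the origin. -/
lemma span_degree_two_monomials_eq :
    (Ideal.span {X 0 ^ 2, X 1 ^ 2, X 2 ^ 2, X 0 * X 1, X 0 * X 2, X 1 * X 2} :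
      Ideal (MvPolynomial (Fin 3) ℝ)) =
    Ideal.span (Set.range X) * Ideal.span (Set.range X) := by
  apply le_antisymm
  · have hX (i j : Fin 3) : (X i * X j : MvPolynomial (Fin 3) ℝ) ∈
        Ideal.span (Set.range X) * Ideal.span (Set.range X) :=
      Ideal.mul_mem_mul (Ideal.subset_span ⟨i, rfl⟩) (Ideal.subset_span ⟨j, rfl⟩)
    rw [Ideal.span_le]
    rintro p (rfl | rfl | rfl | rfl | rfl | rfl) <;> (try rw [sq]) <;> exact hX _ _
  · rw [Ideal.span_mul_span', Ideal.span_le]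
    rintro _ ⟨_, ⟨i, rfl⟩, _, ⟨j, rfl⟩, rfl⟩
    apply Ideal.subset_span
    have h10 : (X 1 * X 0 : MvPolynomial (Fin 3) ℝ) = X 0 * X 1 := mul_comm _ _
    have h20 : (X 2 * X 0 : MvPolynomial (Fin 3) ℝ) = X 0 * X 2 := mul_comm _ _
    have h21 : (X 2 * X 1 : MvPolynomial (Fin 3) ℝ) = X 1 * X 2 := mul_comm _ _
    fin_cases i <;> fin_cases j <;> simp [sq, h10, h20, h21]

/-- Bracketing with any polynomial preserves the square of the ideal of the origin. -/
lemma sl2Bracket_mem_span_X_mul_span_X (f : MvPolynomial (Fin 3) ℝ)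
    {u : MvPolynomial (Fin 3) ℝ}
    (hu : u ∈ Ideal.span (Set.range X) * Ideal.span (Set.range X)) :
    sl2Bracket f u ∈ Ideal.span (Set.range X) * Ideal.span (Set.range X) := by
  induction hu using Submodule.mul_induction_on' with
  | mem_mul_mem g hg h hh =>
    rw [sl2Bracket_mul_right]
    exact add_mem (Ideal.mul_mem_mul (sl2Bracket_mem_span_X f g) hh)
      (Ideal.mul_mem_mul hg (sl2Bracket_mem_span_X f h))
  | add g _ h _ hg hh =>
    rw [sl2Bracket_add_right]
    exact add_mem hg hh

/-- Polynomials in the square of the ideal of the origin have vanishing first order part. -/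
lemma eval_zero_pderiv_eq_zero_of_mem {σ R : Type*} [CommRing R] (i : σ)
    {u : MvPolynomial σ R}
    (hu : u ∈ Ideal.span (Set.range X) * Ideal.span (Set.range X)) :
    eval 0 (pderiv i u) = 0 := by
  have hker : Ideal.span (Set.range X) ≤ RingHom.ker (eval (0 : σ → R)) := by
    rw [Ideal.span_le]
    rintro _ ⟨j, rfl⟩
    simp
  induction hu using Submodule.mul_induction_on' with
  | mem_mul_mem g hg h hh =>
    have hg0 : eval 0 g = 0 := hker hg
    have hh0 : eval 0 h = 0 := hker hh
    simp only [Derivation.leibniz, smul_eq_mul, map_add, map_mul, hg0, hh0, zero_mul, add_zero]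
  | add g _ h _ hg hh => rw [map_add, map_add, hg, hh, add_zero]

/-- With `M²` the ideal generated by the degree two monomials
`x², y², z², xy, xz, yz` and `(C)` the ideal generated by `C = x² + y² − z²`:
(a) `M²` is a Lie ideal; (b) `C ∈ M²`; (c) `{x,y} = -z ∉ M²`, so `M²` does not contain
the derived ideal; (d) some bracket of an element of `M²` with a polynomial is not in
`(C)`, so `M²` is not central modulo `(C)`. -/
theorem nilpotent_cone_not_essentially_simple
    (M2 : Ideal (MvPolynomial (Fin 3) ℝ))
    (hM2 : M2 = Ideal.span {X 0 ^ 2, X 1 ^ 2, X 2 ^ 2, X 0 * X 1, X 0 * X 2, X 1 * X 2})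
    (CIdeal : Ideal (MvPolynomial (Fin 3) ℝ))
    (hCIdeal : CIdeal = Ideal.span {(X 0 ^ 2 + X 1 ^ 2 - X 2 ^ 2 : MvPolynomial (Fin 3) ℝ)}) :
    (∀ f : MvPolynomial (Fin 3) ℝ, ∀ u ∈ M2, sl2Bracket f u ∈ M2) ∧
    (X 0 ^ 2 + X 1 ^ 2 - X 2 ^ 2 : MvPolynomial (Fin 3) ℝ) ∈ M2 ∧
    sl2Bracket (X 0) (X 1) ∉ M2 ∧
    (∃ u ∈ M2, ∃ f : MvPolynomial (Fin 3) ℝ, sl2Bracket u f ∉ CIdeal) := by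
  have hM2' := hM2.trans span_degree_two_monomials_eq
  have hsq (i : Fin 3) : (X i ^ 2 : MvPolynomial (Fin 3) ℝ) ∈ M2 := by
    rw [hM2', sq]
    exact Ideal.mul_mem_mul (Ideal.subset_span ⟨i, rfl⟩) (Ideal.subset_span ⟨i, rfl⟩)
  refine ⟨fun f u hu => ?_, sub_mem (add_mem (hsq 0) (hsq 1)) (hsq 2), fun hmem => ?_,
    X 0 ^ 2, hsq 0, X 1, fun hmem => ?_⟩
  · rw [hM2'] at hu ⊢
    exact sl2Bracket_mem_span_X_mul_span_X f hu
  · rw [hM2'] at hmem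
    have := eval_zero_pderiv_eq_zero_of_mem 2 hmem
    simp [sl2Bracket, pderiv_X] at this
  · rw [hCIdeal, Ideal.mem_span_singleton] at hmem
    have := map_dvd (eval ![(1 : ℝ), 0, 1]) hmem
    simp [sl2Bracket, pderiv_X] at this
end

section
/- On ℝ[x,y,z] with the Lie–Poisson bracket of sl(2,ℝ)*, if f ∈ ℝ[x,y,z] satisfies {f, g} ∈ (x² + y² − z² − 1) for every g ∈ ℝ[x,y,z] (where (x² + y² − z² − 1) denotes the ideal generated by x² + y² − z² − 1), then f = r + p·(x² + y² − z² − 1) for some real number r and some p ∈ ℝ[x,y,z]. That is, the Lie center of the quotient Poisson algebra ℝ[x,y,z]/(x² + y² − z² − 1) consists exactly of the real constants. -/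
open MvPolynomial

namespace MvPolynomial

theorem finSuccEquiv_pderiv_zero {R : Type*} [CommRing R] {n : ℕ}
    (p : MvPolynomial (Fin (n + 1)) R) :
    finSuccEquiv R n (pderiv 0 p) = Polynomial.derivative (finSuccEquiv R n p) := by
  ext i m
  have hi : (i : MvPolynomial (Fin n) R) + 1 = C ((i : R) + 1) := by simp
  rw [finSuccEquiv_coeff_coeff, coeff_pderiv, Polynomial.coeff_derivative, hi, mul_comm _ (C _),
    coeff_C_mul, mul_comm,
    finSuccEquiv_coeff_coeff, Finsupp.cons_zero]
  congr 2
  ext j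
  refine Fin.cases ?_ (fun j => ?_) j <;> simp

theorem eq_C_of_forall_pderiv_eq_zero {σ R : Type*} [CommRing R] [IsDomain R] [CharZero R]
    {p : MvPolynomial σ R} (h : ∀ i, pderiv i p = 0) : p = C (coeff 0 p) := by
  classical
  ext m
  rw [coeff_C]
  split_ifs with hm
  · rw [hm]
  · obtain ⟨i, hi⟩ : ∃ i, m i ≠ 0 := by
      by_contra! h0
      exact hm (Finsupp.ext fun i => (h0 i).symm)
    have hc := coeff_pderiv (i := i) p (m - Finsupp.single i 1)
    have hle : Finsupp.single i 1 ≤ m := by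
      rw [Finsupp.single_le_iff]
      omega
    rw [h i, tsub_add_cancel_of_le hle, coeff_zero, eq_comm, mul_eq_zero] at hc
    exact hc.resolve_right (Nat.cast_add_one_ne_zero _)

/-- The equation of the hyperboloid is monic of degree two in the first variable. -/
theorem finSuccEquiv_hyperboloid :
    finSuccEquiv ℝ 2 (X 0 ^ 2 + X 1 ^ 2 - X 2 ^ 2 - 1) =
      Polynomial.X ^ 2 + Polynomial.C (X 0 ^ 2 - X 1 ^ 2 - 1) := by
  have h1 : finSuccEquiv ℝ 2 (X 1) = Polynomial.C (X 0) := finSuccEquiv_X_succ (j := 0)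
  have h2 : finSuccEquiv ℝ 2 (X 2) = Polynomial.C (X 1) := finSuccEquiv_X_succ (j := 1)
  simp only [map_sub, map_add, map_pow, finSuccEquiv_X_zero, h1, h2, map_one]
  ring

theorem finSuccEquiv_rename_succ {R : Type*} [CommRing R] {n : ℕ} (p : MvPolynomial (Fin n) R) :
    finSuccEquiv R n (rename Fin.succ p) = Polynomial.C p := by
  induction p using MvPolynomial.induction_on with
  | C a => simp [finSuccEquiv_apply]
  | add p q hp hq => simp [hp, hq]
  | mul_X p i hp => rw [map_mul, map_mul, hp, rename_X, finSuccEquiv_X_succ, map_mul]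

theorem exists_eq_linear_add_mul_hyperboloid (f : MvPolynomial (Fin 3) ℝ) :
    ∃ (a b : MvPolynomial (Fin 2) ℝ) (p : MvPolynomial (Fin 3) ℝ),
      f = rename Fin.succ a * X 0 + rename Fin.succ b
        + p * (X 0 ^ 2 + X 1 ^ 2 - X 2 ^ 2 - 1) := by
  set q : Polynomial (MvPolynomial (Fin 2) ℝ) :=
    Polynomial.X ^ 2 + Polynomial.C (X 0 ^ 2 - X 1 ^ 2 - 1) with hq
  have hmonic : q.Monic := Polynomial.monic_X_pow_add_C _ two_ne_zero
  have hdeg : q.natDegree = 2 := Polynomial.natDegree_X_pow_add_C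
  have hlt := Polynomial.natDegree_modByMonic_lt (finSuccEquiv ℝ 2 f) hmonic
    (fun h => by simp [h] at hdeg)
  obtain ⟨a, b, hab⟩ := Polynomial.exists_eq_X_add_C_of_natDegree_le_one
    (p := finSuccEquiv ℝ 2 f %ₘ q) (by omega)
  refine ⟨a, b, (finSuccEquiv ℝ 2).symm (finSuccEquiv ℝ 2 f /ₘ q), ?_⟩
  apply (finSuccEquiv ℝ 2).injective
  rw [map_add, map_add, map_mul, map_mul, AlgEquiv.apply_symm_apply, finSuccEquiv_hyperboloid,
    finSuccEquiv_rename_succ, finSuccEquiv_rename_succ, finSuccEquiv_X_zero, ← hab, ← hq,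
    mul_comm _ q, Polynomial.modByMonic_add_div]

theorem eq_zero_of_linear_mem_span_hyperboloid {a b : MvPolynomial (Fin 2) ℝ}
    (h : rename Fin.succ a * X 0 + rename Fin.succ b ∈
      Ideal.span {(X 0 ^ 2 + X 1 ^ 2 - X 2 ^ 2 - 1 : MvPolynomial (Fin 3) ℝ)}) :
    a = 0 ∧ b = 0 := by
  have hdvd := map_dvd (finSuccEquiv ℝ 2) (Ideal.mem_span_singleton.mp h)
  rw [finSuccEquiv_hyperboloid, map_add, map_mul, finSuccEquiv_rename_succ,
    finSuccEquiv_rename_succ, finSuccEquiv_X_zero] at hdvd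
  have hzero : Polynomial.C a * Polynomial.X + Polynomial.C b = 0 := by
    by_contra h0
    refine (Polynomial.monic_X_pow_add_C _ two_ne_zero).not_dvd_of_degree_lt h0 ?_ hdvd
    rw [Polynomial.degree_X_pow_add_C two_pos]
    exact Polynomial.degree_linear_le.trans_lt (by norm_num)
  constructor
  · simpa using congrArg (Polynomial.coeff · 1) hzero
  · simpa using congrArg (Polynomial.coeff · 0) hzero

end MvPolynomial

theorem Polynomial.eq_zero_of_mul_derivative_eq_X_mul {R : Type*} [CommRing R] [IsDomain R]
    [CharZero R] {c : R} {p : Polynomial R}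
    (h : (Polynomial.C c - Polynomial.X ^ 2) * Polynomial.derivative p = Polynomial.X * p) :
    p = 0 := by
  have hc := congrArg (Polynomial.coeff · (p.natDegree + 1)) h
  have hX : (Polynomial.X ^ 2 * Polynomial.derivative p).coeff (p.natDegree + 1)
      = p.natDegree * p.leadingCoeff := by
    rcases Nat.eq_zero_or_pos p.natDegree with h0 | h0
    · rw [Polynomial.derivative_of_natDegree_zero h0, h0]
      simp
    · obtain ⟨k, hk⟩ := Nat.exists_eq_succ_of_ne_zero h0.ne'
      rw [Polynomial.leadingCoeff, hk, Nat.succ_eq_add_one, add_assoc, Polynomial.coeff_X_pow_mul,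
        Polynomial.coeff_derivative]
      push_cast
      ring
  simp only [sub_mul, Polynomial.coeff_sub, hX, Polynomial.coeff_C_mul,
    Polynomial.coeff_X_mul, Polynomial.coeff_derivative,
    Polynomial.coeff_eq_zero_of_natDegree_lt (show p.natDegree < p.natDegree + 1 + 1 by omega),
    Polynomial.coeff_natDegree] at hc
  have : ((p.natDegree : R) + 1) * p.leadingCoeff = 0 := by linear_combination -hc
  exact Polynomial.leadingCoeff_eq_zero.mp
    ((mul_eq_zero.mp this).resolve_left (Nat.cast_add_one_ne_zero _))

/-- The equation of the hyperboloid is a Casimir, so its multiples form a Poisson ideal. -/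
theorem sl2Bracket_add_mul_hyperboloid (f p g : MvPolynomial (Fin 3) ℝ) :
    sl2Bracket (f + p * (X 0 ^ 2 + X 1 ^ 2 - X 2 ^ 2 - 1)) g =
      sl2Bracket f g + sl2Bracket p g * (X 0 ^ 2 + X 1 ^ 2 - X 2 ^ 2 - 1) := by
  simp only [sl2Bracket, map_add, map_sub, pderiv_mul, pderiv_pow, pderiv_X, pderiv_one]
  simp
  ring

theorem pderiv_zero_rename_succ {n : ℕ} (a : MvPolynomial (Fin n) ℝ) :
    pderiv 0 (rename Fin.succ a) = 0 := by
  apply (finSuccEquiv ℝ n).injective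
  rw [finSuccEquiv_pderiv_zero, finSuccEquiv_rename_succ, Polynomial.derivative_C, map_zero]

theorem sl2Bracket_linear_X_two (a b : MvPolynomial (Fin 2) ℝ) :
    sl2Bracket (rename Fin.succ a * X 0 + rename Fin.succ b) (X 2) =
      rename Fin.succ (pderiv 0 b) * X 0
        + rename Fin.succ ((1 + X 1 ^ 2 - X 0 ^ 2) * pderiv 0 a - X 0 * a)
        + rename Fin.succ (pderiv 0 a) * (X 0 ^ 2 + X 1 ^ 2 - X 2 ^ 2 - 1) := by
  have h (q : MvPolynomial (Fin 2) ℝ) :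
      pderiv 1 (rename Fin.succ q) = rename Fin.succ (pderiv 0 q) :=
    pderiv_rename (Fin.succ_injective 2) 0 q
  simp only [sl2Bracket, map_add, map_sub, pderiv_mul, pderiv_X, h, pderiv_zero_rename_succ]
  simp
  ring

theorem sl2Bracket_rename_succ_X_one (b : MvPolynomial (Fin 2) ℝ) :
    sl2Bracket (rename Fin.succ b) (X 1) =
      rename Fin.succ (-pderiv 1 b) * X 0 + rename Fin.succ 0 := by
  have h : pderiv 2 (rename Fin.succ b) = rename Fin.succ (pderiv 1 b) :=
    pderiv_rename (Fin.succ_injective 2) 1 b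
  simp only [sl2Bracket, pderiv_X, h, pderiv_zero_rename_succ]
  simp
  ring

/-- On `ℝ[x,y,z]` with the Lie–Poisson bracket of `sl(2,ℝ)*`, if `f`
brackets every polynomial into the ideal `(x² + y² − z² − 1)`, then `f` is a real
constant modulo that ideal: the Lie center of the quotient Poisson algebra consists
exactly of the real constants. -/
theorem lie_center_of_hyperboloid_is_constants
    (f : MvPolynomial (Fin 3) ℝ)
    (hf : ∀ g : MvPolynomial (Fin 3) ℝ,
      sl2Bracket f g ∈
        Ideal.span {(X 0 ^ 2 + X 1 ^ 2 - X 2 ^ 2 - 1 : MvPolynomial (Fin 3) ℝ)}) :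
    ∃ (r : ℝ) (p : MvPolynomial (Fin 3) ℝ),
      f = C r + p * (X 0 ^ 2 + X 1 ^ 2 - X 2 ^ 2 - 1) := by
  obtain ⟨a, b, p, rfl⟩ := exists_eq_linear_add_mul_hyperboloid f
  have hlin (g : MvPolynomial (Fin 3) ℝ) :
      sl2Bracket (rename Fin.succ a * X 0 + rename Fin.succ b) g ∈
        Ideal.span {(X 0 ^ 2 + X 1 ^ 2 - X 2 ^ 2 - 1 : MvPolynomial (Fin 3) ℝ)} := by
    have hg := hf g
    rwa [sl2Bracket_add_mul_hyperboloid, Ideal.add_mem_iff_left _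
      (Ideal.mul_mem_left _ _ (Ideal.mem_span_singleton_self _))] at hg
  have h2 := hlin (X 2)
  rw [sl2Bracket_linear_X_two, Ideal.add_mem_iff_left _
    (Ideal.mul_mem_left _ _ (Ideal.mem_span_singleton_self _))] at h2
  obtain ⟨hb0, ha⟩ := eq_zero_of_linear_mem_span_hyperboloid h2
  obtain rfl : a = 0 := by
    apply (finSuccEquiv ℝ 1).injective
    rw [map_zero]
    apply Polynomial.eq_zero_of_mul_derivative_eq_X_mul (c := 1 + X 0 ^ 2)
    have h1 : finSuccEquiv ℝ 1 (X 1) = Polynomial.C (X 0) := finSuccEquiv_X_succ (j := 0)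
    simpa [finSuccEquiv_pderiv_zero, finSuccEquiv_X_zero, h1]
      using congrArg (finSuccEquiv ℝ 1) (sub_eq_zero.mp ha)
  have h1 := hlin (X 1)
  rw [map_zero, zero_mul, zero_add, sl2Bracket_rename_succ_X_one] at h1
  have hb1 := neg_eq_zero.mp (eq_zero_of_linear_mem_span_hyperboloid h1).1
  refine ⟨coeff 0 b, p, ?_⟩
  have hb := eq_C_of_forall_pderiv_eq_zero (Fin.forall_fin_two.mpr ⟨hb0, hb1⟩)
  rw [map_zero, zero_mul, zero_add, add_left_inj]
  conv_lhs => rw [hb, rename_C]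
end
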